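/- arXiv:1603.08487 — 2 statements merged into one kernel-verified Lean document; each statement's English description precedes it below -/
import Mathlib

section
/- In Y_{d,n}^B, for 1 ≤ k ≤ n−1 the following braid-type relations hold: (i) g_k b_k g_k b_k = b_k g_k b_k g_k; and (ii) g_k b_k b_{k+1} = b_k g_k b_k. -/
noncomputable section

/-- The field `K = ℂ(u,v)` of rational functions in two indeterminates over `ℂ`. -/
abbrev Kf : Type := FractionRing (MvPolynomial (Fin 2) ℂ)

/-- The indeterminate `u`. -/
def uu : Kf := algebraMap (MvPolynomial (Fin 2) ℂ) Kf (MvPolynomial.X 0)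

/-- The indeterminate `v`. -/
def vv : Kf := algebraMap (MvPolynomial (Fin 2) ℂ) Kf (MvPolynomial.X 1)

/-- Generators of the framization of the Hecke algebra of type B on `n` strands:
`b` is the generator `b₁`, `g i` is the braiding generator `g_{i+1}` (`i : Fin (n-1)`),
and `t j` is the framing generator `t_{j+1}` (`j : Fin n`). -/
inductive Gen (n : ℕ) : Type
  | b : Gen n
  | g : Fin (n - 1) → Gen n
  | t : Fin n → Gen n

/-- The free algebra on the generators. -/
abbrev FA (n : ℕ) : Type := FreeAlgebra Kf (Gen n)

/-- The generator `b₁` in the free algebra. -/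
def Bb (n : ℕ) : FA n := FreeAlgebra.ι Kf Gen.b

/-- The generator `g_i` (for `1 ≤ i ≤ n-1`) in the free algebra; junk value `1` out of range. -/
def Gg (n i : ℕ) : FA n :=
  if h : 1 ≤ i ∧ i ≤ n - 1 then FreeAlgebra.ι Kf (Gen.g ⟨i - 1, by omega⟩) else 1

/-- The generator `t_j` (for `1 ≤ j ≤ n`) in the free algebra; junk value `1` out of range. -/
def Tt (n j : ℕ) : FA n :=
  if h : 1 ≤ j ∧ j ≤ n then FreeAlgebra.ι Kf (Gen.t ⟨j - 1, by omega⟩) else 1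

/-- The element `e_i = (1/d) ∑_{m=0}^{d-1} t_i^m t_{i+1}^{d-m}` in the free algebra. -/
def eF (d n i : ℕ) : FA n :=
  (d : Kf)⁻¹ • ∑ m ∈ Finset.range d, Tt n i ^ m * Tt n (i + 1) ^ (d - m)

/-- The element `f₁ = (1/d) ∑_{m=0}^{d-1} t₁^m` in the free algebra. -/
def fF (d n : ℕ) : FA n :=
  (d : Kf)⁻¹ • ∑ m ∈ Finset.range d, Tt n 1 ^ m

/-- The action of the simple transposition `s_i` on indices: swaps `i` and `i+1`. -/
def sAct (i j : ℕ) : ℕ := if j = i then i + 1 else if j = i + 1 then i else j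

/-- The defining relations of the framization `Y_{d,n}^B` of the Hecke algebra of type B. -/
inductive YBrel (d n : ℕ) : FA n → FA n → Prop
  | gg : ∀ i j : ℕ, 1 ≤ i → i ≤ n - 1 → 1 ≤ j → j ≤ n - 1 → (i + 1 < j ∨ j + 1 < i) →
      YBrel d n (Gg n i * Gg n j) (Gg n j * Gg n i)
  | braid : ∀ i : ℕ, 1 ≤ i → i ≤ n - 2 →
      YBrel d n (Gg n i * Gg n (i + 1) * Gg n i) (Gg n (i + 1) * Gg n i * Gg n (i + 1))
  | bg : ∀ i : ℕ, 2 ≤ i → i ≤ n - 1 → YBrel d n (Bb n * Gg n i) (Gg n i * Bb n)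
  | bgbg : YBrel d n (Bb n * Gg n 1 * Bb n * Gg n 1) (Gg n 1 * Bb n * Gg n 1 * Bb n)
  | tt : ∀ i j : ℕ, 1 ≤ i → i ≤ n → 1 ≤ j → j ≤ n →
      YBrel d n (Tt n i * Tt n j) (Tt n j * Tt n i)
  | tg : ∀ i j : ℕ, 1 ≤ i → i ≤ n - 1 → 1 ≤ j → j ≤ n →
      YBrel d n (Tt n j * Gg n i) (Gg n i * Tt n (sAct i j))
  | tb : ∀ i : ℕ, 1 ≤ i → i ≤ n → YBrel d n (Tt n i * Bb n) (Bb n * Tt n i)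
  | td : ∀ i : ℕ, 1 ≤ i → i ≤ n → YBrel d n (Tt n i ^ d) 1
  | gsq : ∀ i : ℕ, 1 ≤ i → i ≤ n - 1 →
      YBrel d n (Gg n i ^ 2) (1 + (uu - uu⁻¹) • (eF d n i * Gg n i))
  | bsq : YBrel d n (Bb n ^ 2) (1 + (vv - vv⁻¹) • (fF d n * Bb n))

/-- The framization of the Hecke algebra of type B, `Y_{d,n}^B`. -/
abbrev YB (d n : ℕ) : Type := RingQuot (YBrel d n)

instance (d n : ℕ) : Ring (YB d n) := RingQuot.instRing (YBrel d n)

instance (d n : ℕ) : Algebra Kf (YB d n) := RingQuot.instAlgebra _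

instance (d n : ℕ) : Module Kf (YB d n) := Algebra.toModule

/-- The canonical projection from the free algebra onto `Y_{d,n}^B`. -/
def mkY (d n : ℕ) : FA n →ₐ[Kf] YB d n := RingQuot.mkAlgHom Kf (YBrel d n)

/-- The generator `b₁` of `Y_{d,n}^B`. -/
def bY (d n : ℕ) : YB d n := mkY d n (Bb n)

/-- The generator `g_i` of `Y_{d,n}^B`. -/
def gY (d n : ℕ) (i : ℕ) : YB d n := mkY d n (Gg n i)

/-- The generator `t_j` of `Y_{d,n}^B`. -/
def tY (d n : ℕ) (j : ℕ) : YB d n := mkY d n (Tt n j)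

/-- The idempotent `e_i` of `Y_{d,n}^B`. -/
def eY (d n : ℕ) (i : ℕ) : YB d n := mkY d n (eF d n i)

/-- The idempotent `f₁` of `Y_{d,n}^B`. -/
def fY (d n : ℕ) : YB d n := mkY d n (fF d n)

/-- The element `g_i⁻¹ = g_i - (u - u⁻¹) e_i`. -/
def gInv (d n i : ℕ) : YB d n := gY d n i - (uu - uu⁻¹) • eY d n i

/-- The elements `b_k := g_{k-1} ⋯ g_1 b_1 g_1⁻¹ ⋯ g_{k-1}⁻¹` for `2 ≤ k ≤ n`,
defined by `b_k = g_{k-1} b_{k-1} g_{k-1}⁻¹`; with `b_1` the generator `b₁`. -/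
def bk (d n : ℕ) : ℕ → YB d n
  | 0 => 1
  | 1 => bY d n
  | (k + 2) => gY d n (k + 1) * bk d n (k + 1) * gInv d n (k + 1)

theorem YBrel.mkY_eq {d n : ℕ} {x y : FA n} (h : YBrel d n x y) : mkY d n x = mkY d n y :=
  RingQuot.mkAlgHom_rel Kf h

theorem eY_eq (d n i : ℕ) :
    eY d n i = (d : Kf)⁻¹ • ∑ m ∈ Finset.range d, tY d n i ^ m * tY d n (i + 1) ^ (d - m) := by
  simp [eY, eF, tY]

theorem commute_eY_gY {d n i : ℕ} (hi : 1 ≤ i) (hin : i ≤ n - 1) :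
    Commute (eY d n i) (gY d n i) := by
  have h₁ : SemiconjBy (gY d n i) (tY d n (i + 1)) (tY d n i) := by
    simpa [gY, tY, sAct, SemiconjBy] using
      (YBrel.tg (d := d) i i hi hin hi (by omega)).mkY_eq.symm
  have h₂ : SemiconjBy (gY d n i) (tY d n i) (tY d n (i + 1)) := by
    simpa [gY, tY, sAct, SemiconjBy] using
      (YBrel.tg (d := d) (n := n) i (i + 1) hi hin (by omega) (by omega)).mkY_eq.symm
  have hc : Commute (tY d n i) (tY d n (i + 1)) := by
    simpa [tY, Commute, SemiconjBy] using
      (YBrel.tt (d := d) (n := n) i (i + 1) hi (by omega) (by omega) (by omega)).mkY_eq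
  have hd₁ : tY d n i ^ d = 1 := by
    simpa [tY] using (YBrel.td (d := d) (n := n) i hi (by omega)).mkY_eq
  have hd₂ : tY d n (i + 1) ^ d = 1 := by
    simpa [tY] using (YBrel.td (d := d) (n := n) (i + 1) (by omega) (by omega)).mkY_eq
  have hrefl : ∑ m ∈ Finset.range d, tY d n (i + 1) ^ m * tY d n i ^ (d - m) =
      ∑ m ∈ Finset.range d, tY d n i ^ m * tY d n (i + 1) ^ (d - m) := by
    rcases d with _ | d
    · simp
    rw [Finset.sum_range_succ', Finset.sum_range_succ', ← Finset.sum_range_reflect _ d]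
    congr 1
    · refine Finset.sum_congr rfl fun m hm => ?_
      have hm := Finset.mem_range.1 hm
      rw [show d - 1 - m + 1 = d + 1 - (m + 1) by omega,
        show d + 1 - (d + 1 - (m + 1)) = m + 1 by omega]
      exact (hc.pow_pow _ _).eq.symm
    · simp [hd₁, hd₂]
  rw [eY_eq]
  refine Commute.smul_left ?_ _
  rw [commute_iff_eq, Finset.sum_mul, ← hrefl, Finset.mul_sum]
  exact Finset.sum_congr rfl fun m _ => ((h₁.pow_right m).mul_right (h₂.pow_right (d - m))).eq.symm

theorem gY_mul_self {d n i : ℕ} (hi : 1 ≤ i) (hin : i ≤ n - 1) :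
    gY d n i * gY d n i = 1 + (uu - uu⁻¹) • (eY d n i * gY d n i) := by
  simpa [gY, eY, pow_two] using (YBrel.gsq (d := d) i hi hin).mkY_eq

theorem gInv_mul_gY {d n i : ℕ} (hi : 1 ≤ i) (hin : i ≤ n - 1) :
    gInv d n i * gY d n i = 1 := by
  rw [gInv, sub_mul, gY_mul_self hi hin, smul_mul_assoc, add_sub_cancel_right]

theorem gY_mul_gInv {d n i : ℕ} (hi : 1 ≤ i) (hin : i ≤ n - 1) :
    gY d n i * gInv d n i = 1 := by
  rw [gInv, mul_sub, gY_mul_self hi hin, mul_smul_comm, (commute_eY_gY hi hin).eq,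
    add_sub_cancel_right]

/-- The generator `g_i` as a unit of `Y_{d,n}^B`. -/
def gUnit (d n i : ℕ) (hi : 1 ≤ i) (hin : i ≤ n - 1) : (YB d n)ˣ :=
  ⟨gY d n i, gInv d n i, gY_mul_gInv hi hin, gInv_mul_gY hi hin⟩

theorem bk_succ (d n : ℕ) {k : ℕ} (hk : 1 ≤ k) :
    bk d n (k + 1) = gY d n k * bk d n k * gInv d n k := by
  obtain ⟨k, rfl⟩ := Nat.exists_eq_add_of_le' hk
  rfl

theorem commute_bk_gY {d n k j : ℕ} (hk : 1 ≤ k) (hkj : k < j) (hj : j ≤ n - 1) :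
    Commute (bk d n k) (gY d n j) := by
  induction k, hk using Nat.le_induction with
  | base => simpa [bk, bY, gY, Commute, SemiconjBy] using (YBrel.bg (d := d) j hkj hj).mkY_eq
  | succ k hk ih =>
    have hg : Commute (gY d n k) (gY d n j) := by
      simpa [gY, Commute, SemiconjBy] using
        (YBrel.gg (d := d) (n := n) k j hk (by omega) (by omega) hj (Or.inl hkj)).mkY_eq
    have hgInv : Commute (gInv d n k) (gY d n j) :=
      Commute.units_inv_left (u := gUnit d n k hk (by omega)) hg
    rw [bk_succ d n hk]
    exact (hg.mul_left (ih (by omega))).mul_left hgInv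

/-- The type-B braid relation between `x` and `b` is transported to `y` and `x b x⁻¹`
when `x, y` satisfy the type-A braid relation and `y` commutes with `b`. -/
theorem Units.braid_conj {M : Type*} [Monoid M] (x y : Mˣ) {b : M}
    (hxy : (x * y * x : M) = y * x * y) (hyb : Commute b (y : M))
    (hb : x * b * x * b = b * x * b * x) :
    y * (x * b * ↑x⁻¹) * y * (x * b * ↑x⁻¹) = (x * b * ↑x⁻¹) * y * (x * b * ↑x⁻¹) * y := by
  have hwb : SemiconjBy ((x * y : Mˣ) : M) b (x * b * ↑x⁻¹) := by
    simp only [SemiconjBy, Units.val_mul, mul_assoc, Units.inv_mul_cancel_left, hyb.eq]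
  have hwx : SemiconjBy ((x * y : Mˣ) : M) x y := by
    simpa [SemiconjBy, mul_assoc] using hxy
  rw [← Units.mul_left_inj (x * y),
    ← (((hwx.mul_right hwb).mul_right hwx).mul_right hwb).eq, hb,
    (((hwb.mul_right hwx).mul_right hwb).mul_right hwx).eq]

theorem gY_bk_braid {d n k : ℕ} (hk : 1 ≤ k) (hkn : k ≤ n - 1) :
    gY d n k * bk d n k * gY d n k * bk d n k = bk d n k * gY d n k * bk d n k * gY d n k := by
  induction k, hk using Nat.le_induction with
  | base => simpa [bk, bY, gY] using (YBrel.bgbg (d := d) (n := n)).mkY_eq.symm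
  | succ k hk ih =>
    have hbraid : gY d n k * gY d n (k + 1) * gY d n k =
        gY d n (k + 1) * gY d n k * gY d n (k + 1) := by
      simpa [gY] using (YBrel.braid (d := d) (n := n) k hk (by omega)).mkY_eq
    rw [bk_succ d n hk]
    exact Units.braid_conj (gUnit d n k hk (by omega)) (gUnit d n (k + 1) (by omega) hkn)
      hbraid (commute_bk_gY hk (Nat.lt_succ_self k) hkn) (ih (by omega))

/-- the braid-type relations `g_k b_k g_k b_k = b_k g_k b_k g_k` and
`g_k b_k b_{k+1} = b_k g_k b_k` for `1 ≤ k ≤ n-1`. -/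
theorem stmt3 (d n : ℕ) (hd : 1 ≤ d) (hn : 2 ≤ n) (k : ℕ) (hk : 1 ≤ k) (hk2 : k ≤ n - 1) :
    gY d n k * bk d n k * gY d n k * bk d n k = bk d n k * gY d n k * bk d n k * gY d n k ∧
    gY d n k * bk d n k * bk d n (k + 1) = bk d n k * gY d n k * bk d n k := by
  refine ⟨gY_bk_braid hk hk2, ?_⟩
  rw [bk_succ d n hk, ← mul_assoc, ← mul_assoc, gY_bk_braid hk hk2, mul_assoc _ _ (gInv d n k),
    gY_mul_gInv hk hk2, mul_one]
end
end

section
/- Let w ∈ W_n be parameterized by (m_1, …, m_n) ∈ X_n^n (i.e. m_i = w(i)). Then (v_1^{r_1} ⊗ ⋯ ⊗ v_n^{r_n})Φ_w = v_{m_1}^{r_{|m_1|}} ⊗ ⋯ ⊗ v_{m_n}^{r_{|m_n|}} for all framings r_1, …, r_n ∈ {0, …, d−1}. -/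
set_option maxHeartbeats 1000000
set_option synthInstance.maxHeartbeats 400000

noncomputable section

/-- The index set `X_n = {-n, …, -1, 1, …, n}`. -/
abbrev Xn (n : ℕ) : Type := {i : ℤ // i ≠ 0 ∧ i.natAbs ≤ n}

/-- Negation on `X_n`. -/
def negX (n : ℕ) (x : Xn n) : Xn n :=
  ⟨-x.val, by obtain ⟨h1, h2⟩ := x.2; omega⟩

/-- The index set of the natural basis of `V^{⊗n}`: a basis vector
`v_{i_1}^{r_1} ⊗ ⋯ ⊗ v_{i_n}^{r_n}` corresponds to the function `p ↦ (i_{p+1}, r_{p+1})`. -/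
abbrev BIdx (d n : ℕ) : Type := Fin n → Xn n × Fin d

/-- The vector space `V^{⊗n}`, realized as the space with basis indexed by `BIdx d n`. -/
abbrev Vn (d n : ℕ) : Type := BIdx d n →₀ Kf

/-- The basis vector of `V^{⊗n}` indexed by `f`. -/
def bv (d n : ℕ) (f : BIdx d n) : Vn d n := Finsupp.single f 1

/-- The endomorphism of `V^{⊗n}` with prescribed values on the basis. -/
def opOf (d n : ℕ) (F : BIdx d n → Vn d n) : Module.End Kf (Vn d n) :=
  Finsupp.linearCombination Kf F

/-- The image in `K` of a complex number (in particular of the root of unity `ω`). -/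
def cK (w : ℂ) : Kf := algebraMap (MvPolynomial (Fin 2) ℂ) Kf (MvPolynomial.C w)

/-- The endomorphism `T_k = 1⊗⋯⊗T⊗⋯⊗1` of `V^{⊗n}` (for `1 ≤ k ≤ n`; junk `1` out of
range), where `(v_i^r) T = ω^r v_i^r`. -/
def TOp (w : ℂ) (d n k : ℕ) : Module.End Kf (Vn d n) :=
  if h : 1 ≤ k ∧ k ≤ n then
    opOf d n (fun f => cK w ^ ((f ⟨k - 1, by omega⟩).2 : ℕ) • bv d n f)
  else 1

/-- The inverse `T_k⁻¹` of the endomorphism `T_k`. -/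
def TinvOp (w : ℂ) (d n k : ℕ) : Module.End Kf (Vn d n) :=
  if h : 1 ≤ k ∧ k ≤ n then
    opOf d n (fun f => (cK w ^ ((f ⟨k - 1, by omega⟩).2 : ℕ))⁻¹ • bv d n f)
  else 1

/-- The endomorphism `E_k = (1/d) ∑_{m=0}^{d-1} T_k^m T_{k+1}^{-m}`. -/
def EOp (w : ℂ) (d n k : ℕ) : Module.End Kf (Vn d n) :=
  (d : Kf)⁻¹ • ∑ m ∈ Finset.range d, TOp w d n k ^ m * TinvOp w d n (k + 1) ^ m

/-- The endomorphism `F = (1/d) ∑_{m=0}^{d-1} T_1^m`. -/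
def FOp (w : ℂ) (d n : ℕ) : Module.End Kf (Vn d n) :=
  (d : Kf)⁻¹ • ∑ m ∈ Finset.range d, TOp w d n 1 ^ m

/-- The endomorphism `G_i = 1⊗⋯⊗G⊗⋯⊗1` of `V^{⊗n}` (acting on the tensor factors `i`,
`i+1`, for `1 ≤ i ≤ n-1`; junk `1` out of range). -/
def GOp (d n i : ℕ) : Module.End Kf (Vn d n) :=
  if h : 1 ≤ i ∧ i ≤ n - 1 then
    opOf d n (fun f =>
      let p : Fin n := ⟨i - 1, by omega⟩
      let q : Fin n := ⟨i, by omega⟩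
      let fs : BIdx d n := f ∘ (Equiv.swap p q)
      if (f p).2 ≠ (f q).2 then bv d n fs
      else if (f p).1.val = (f q).1.val then uu • bv d n fs
      else if (f p).1.val < (f q).1.val then bv d n fs
      else bv d n fs + (uu - uu⁻¹) • bv d n f)
  else 1

/-- The endomorphism `B_1` of `V^{⊗n}`. -/
def BOp (d n : ℕ) : Module.End Kf (Vn d n) :=
  if h : 1 ≤ n then
    opOf d n (fun f =>
      let p : Fin n := ⟨0, by omega⟩
      let fneg : BIdx d n := Function.update f p (negX n (f p).1, (f p).2)
      if ((f p).2 : ℕ) ≠ 0 then bv d n fneg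
      else if 0 < (f p).1.val then bv d n fneg
      else bv d n fneg + (vv - vv⁻¹) • bv d n f)
  else 1

/-- The element `i ∈ X_n` for `1 ≤ i ≤ n`. -/
def xe (n i : ℕ) (h1 : 1 ≤ i) (h2 : i ≤ n) : Xn n := ⟨(i : ℤ), by omega⟩

/-- The element `-i ∈ X_n` for `1 ≤ i ≤ n`. -/
def xen (n i : ℕ) (h1 : 1 ≤ i) (h2 : i ≤ n) : Xn n := ⟨-(i : ℤ), by omega⟩

/-- The Coxeter generating letters of `W_n`: `r` (the generator `r₁`)
and `s i` (the generator `s_i`) for `1 ≤ i ≤ n-1`. -/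
inductive Letter (n : ℕ) : Type
  | r (h : 1 ≤ n) : Letter n
  | s (i : ℕ) (h1 : 1 ≤ i) (h2 : i ≤ n - 1) : Letter n

/-- The realization of the Coxeter generators of `W_n` as (signed) permutations of
`X_n`: `r₁` is the sign change `1 ↔ -1`, and `s_i` swaps `±i` with `±(i+1)`. -/
def letterPerm {n : ℕ} : Letter n → Equiv.Perm (Xn n)
  | .r h => Equiv.swap (xe n 1 le_rfl h) (xen n 1 le_rfl h)
  | .s i h1 h2 =>
      Equiv.swap (xe n i h1 (by omega)) (xe n (i + 1) (by omega) (by omega)) *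
      Equiv.swap (xen n i h1 (by omega)) (xen n (i + 1) (by omega) (by omega))

/-- The operators corresponding to the letters: `B₁` for `r₁` and `G_i` for `s_i`. -/
def letterOp (d n : ℕ) : Letter n → Module.End Kf (Vn d n)
  | .r _ => BOp d n
  | .s i _ _ => GOp d n i

/-- The element of `X_n` corresponding to the `(p+1)`-st tensor position. -/
def posX (n : ℕ) (p : Fin n) : Xn n := ⟨((p : ℕ) : ℤ) + 1, by have := p.isLt; omega⟩

/-- The tensor position (in `Fin n`) corresponding to `|x|` for `x ∈ X_n`. -/
def absIdx (n : ℕ) (x : Xn n) : Fin n := ⟨x.val.natAbs - 1, by have := x.2; omega⟩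

section SignedPermutations

variable {n : ℕ}

lemma letterPerm_r_val (h : 1 ≤ n) (x : Xn n) :
    (letterPerm (.r h) x).val = if x.val = 1 ∨ x.val = -1 then -x.val else x.val := by
  simp only [letterPerm, Equiv.swap_apply_def, xe, xen, Subtype.ext_iff]
  split_ifs <;> simp_all

lemma letterPerm_s_val (i : ℕ) (h1 : 1 ≤ i) (h2 : i ≤ n - 1) (x : Xn n) :
    (letterPerm (.s i h1 h2) x).val =
      if x.val = i then (i : ℤ) + 1 else if x.val = i + 1 then (i : ℤ)
      else if x.val = -i then -(i : ℤ) - 1 else if x.val = -i - 1 then -(i : ℤ)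
      else x.val := by
  simp only [letterPerm, Equiv.Perm.mul_apply, Equiv.swap_apply_def, xe, xen, Subtype.ext_iff]
  push_cast
  split_ifs <;> first | omega | (simp_all; done) | (simp_all; omega)

lemma negX_val (x : Xn n) : (negX n x).val = -x.val := rfl

lemma letterPerm_negX (a : Letter n) (x : Xn n) :
    letterPerm a (negX n x) = negX n (letterPerm a x) := by
  apply Subtype.ext
  cases a with
  | r h =>
    simp only [negX_val, letterPerm_r_val]
    split_ifs <;> omega
  | s i h1 h2 =>
    simp only [negX_val, letterPerm_s_val]
    split_ifs <;> omega

lemma letterPerm_mul_self (a : Letter n) : letterPerm a * letterPerm a = 1 := by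
  ext x
  rw [Equiv.Perm.mul_apply, Equiv.Perm.one_apply]
  cases a with
  | r h =>
    simp only [letterPerm_r_val]
    split_ifs <;> omega
  | s i h1 h2 =>
    simp only [letterPerm_s_val]
    split_ifs <;> omega

lemma prod_letterPerm_negX (L : List (Letter n)) (x : Xn n) :
    (L.map letterPerm).prod (negX n x) = negX n ((L.map letterPerm).prod x) := by
  induction L with
  | nil => rfl
  | cons a L ih =>
    simp only [List.map_cons, List.prod_cons, Equiv.Perm.mul_apply, ih, letterPerm_negX]

/-- The smaller element of the positive root of a Coxeter generator, viewed as a pair in `X_n`. -/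
def rootLo : Letter n → Xn n
  | .r h => xen n 1 le_rfl h
  | .s i h1 _ => xe n i h1 (by omega)

/-- The larger element of the positive root of a Coxeter generator, viewed as a pair in `X_n`. -/
def rootHi : Letter n → Xn n
  | .r h => xe n 1 le_rfl h
  | .s i _ _ => xe n (i + 1) (by omega) (by omega)

lemma rootLo_lt_rootHi (a : Letter n) : (rootLo a).val < (rootHi a).val := by
  cases a <;> simp [rootLo, rootHi, xe, xen]

/-- A Coxeter generator reverses the order of a pair in `X_n` only if this pair is its own root,
up to sign. -/
lemma eq_root_of_reverses (t : Letter n) (x y : Xn n) (hxy : x.val < y.val)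
    (ht : (letterPerm t y).val < (letterPerm t x).val) :
    (x = rootLo t ∧ y = rootHi t) ∨ (x = negX n (rootHi t) ∧ y = negX n (rootLo t)) := by
  simp only [Subtype.ext_iff, negX_val]
  have := x.2
  have := y.2
  cases t with
  | r h =>
    simp only [letterPerm_r_val] at ht
    simp only [rootLo, rootHi, xe, xen]
    split_ifs at ht <;> omega
  | s i h1 h2 =>
    simp only [letterPerm_s_val] at ht
    simp only [rootLo, rootHi, xe]
    split_ifs at ht <;> omega

lemma swap_val (x y z : Xn n) : (Equiv.swap x y z).val =
    if z.val = x.val then y.val else if z.val = y.val then x.val else z.val := by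
  simp only [Equiv.swap_apply_def, Subtype.ext_iff]
  split_ifs <;> rfl

/-- A Coxeter generator is the reflection attached to its root, up to sign. -/
lemma letterPerm_eq_of_root (t : Letter n) (x y : Xn n)
    (h : (x = rootLo t ∧ y = rootHi t) ∨ (x = negX n (rootHi t) ∧ y = negX n (rootLo t))) :
    letterPerm t = if x = negX n y then Equiv.swap x y
      else Equiv.swap x y * Equiv.swap (negX n x) (negX n y) := by
  cases t with
  | r hr =>
    simp only [Subtype.ext_iff, negX_val, rootLo, rootHi, xe, xen] at h
    rw [if_pos (Subtype.ext (by rw [negX_val]; omega))]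
    ext z
    rw [letterPerm_r_val, swap_val]
    split_ifs <;> omega
  | s i h1 h2 =>
    simp only [Subtype.ext_iff, negX_val, rootLo, rootHi, xe] at h
    rw [if_neg (fun hxy => by rw [Subtype.ext_iff, negX_val] at hxy; omega)]
    ext z
    rw [letterPerm_s_val, Equiv.Perm.mul_apply, swap_val, swap_val, negX_val, negX_val]
    split_ifs <;> omega

/-- If a generator `t` reverses the image under `u` of the root of `a`, then `t` is the conjugate
of `a` by `u`. -/
lemma letterPerm_mul_eq_of_reverses (u : Equiv.Perm (Xn n))
    (hu : ∀ x, u (negX n x) = negX n (u x)) (a t : Letter n)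
    (hlt : (u (rootLo a)).val < (u (rootHi a)).val)
    (ht : (letterPerm t (u (rootHi a))).val < (letterPerm t (u (rootLo a))).val) :
    letterPerm t * u = u * letterPerm a := by
  rw [letterPerm_eq_of_root t _ _ (eq_root_of_reverses t _ _ hlt ht),
    letterPerm_eq_of_root a _ _ (.inl ⟨rfl, rfl⟩), ← hu, ← hu]
  simp only [u.injective.eq_iff]
  split_ifs
  · rw [Equiv.mul_swap_eq_swap_mul]
  · rw [← mul_assoc, Equiv.mul_swap_eq_swap_mul u, mul_assoc, mul_assoc,
      Equiv.mul_swap_eq_swap_mul u]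

/-- The exchange condition for `W_n`. -/
lemma exists_shorter_of_reverses (a : Letter n) (L : List (Letter n))
    (h : ((L.map letterPerm).prod (rootHi a)).val < ((L.map letterPerm).prod (rootLo a)).val) :
    ∃ L' : List (Letter n), L'.length < L.length ∧
      (L'.map letterPerm).prod = (L.map letterPerm).prod * letterPerm a := by
  induction L with
  | nil => exact absurd h (rootLo_lt_rootHi a).not_gt
  | cons t L ih =>
    simp only [List.map_cons, List.prod_cons, Equiv.Perm.mul_apply] at h
    rcases lt_trichotomy ((L.map letterPerm).prod (rootHi a)).val
      ((L.map letterPerm).prod (rootLo a)).val with hlt | heq | hgt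
    · obtain ⟨L', hlen, hprod⟩ := ih hlt
      exact ⟨t :: L', by simpa using hlen, by simp [hprod, mul_assoc]⟩
    · rw [Subtype.ext heq] at h
      exact absurd h (lt_irrefl _)
    · refine ⟨L, by simp, ?_⟩
      rw [List.map_cons, List.prod_cons, mul_assoc,
        ← letterPerm_mul_eq_of_reverses _ (prod_letterPerm_negX L) a t hgt h, ← mul_assoc,
        letterPerm_mul_self, one_mul]

/-- In a reduced expression ending in `a`, the remaining product keeps the root of `a` in order. -/
lemma root_lt_of_reduced (a : Letter n) (L : List (Letter n))
    (hred : ∀ L' : List (Letter n), (L'.map letterPerm).prod = ((L ++ [a]).map letterPerm).prod →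
      (L ++ [a]).length ≤ L'.length) :
    ((L.map letterPerm).prod (rootLo a)).val < ((L.map letterPerm).prod (rootHi a)).val := by
  by_contra! hle
  have hne : ((L.map letterPerm).prod (rootHi a)).val ≠
      ((L.map letterPerm).prod (rootLo a)).val := fun h =>
    (rootLo_lt_rootHi a).ne' (congrArg Subtype.val (Equiv.injective _ (Subtype.ext h)))
  obtain ⟨L', hlen, hprod⟩ := exists_shorter_of_reverses a L (lt_of_le_of_ne hle hne)
  have := hred L' (by simpa using hprod)
  simp only [List.length_append, List.length_singleton] at this
  omega

lemma reduced_of_append (a : Letter n) (L : List (Letter n))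
    (hred : ∀ L' : List (Letter n), (L'.map letterPerm).prod = ((L ++ [a]).map letterPerm).prod →
      (L ++ [a]).length ≤ L'.length) (L' : List (Letter n))
    (h : (L'.map letterPerm).prod = (L.map letterPerm).prod) : L.length ≤ L'.length := by
  simpa using hred (L' ++ [a]) (by simp [h])

end SignedPermutations

lemma opOf_bv (d n : ℕ) (F : BIdx d n → Vn d n) (f : BIdx d n) :
    opOf d n F (bv d n f) = F f := by
  simp [opOf, bv]

/-- The index of the basis vector `v_{m_1}^{r_{|m_1|}} ⊗ ⋯ ⊗ v_{m_n}^{r_{|m_n|}}`, where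
`m_i = w(i)`. -/
def permIdx {d n : ℕ} (r : Fin n → Fin d) (w : Equiv.Perm (Xn n)) : BIdx d n :=
  fun p => (w (posX n p), r (absIdx n (w (posX n p))))

lemma absIdx_negX (n : ℕ) (x : Xn n) : absIdx n (negX n x) = absIdx n x := by
  simp [absIdx, negX_val]

/-- A generator acts on the basis vector of `w` by right multiplication of `w`, as long as `w`
keeps its root in order. -/
lemma letterOp_bv_permIdx {d n : ℕ} (r : Fin n → Fin d) (w : Equiv.Perm (Xn n))
    (hw : ∀ x, w (negX n x) = negX n (w x)) (a : Letter n)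
    (hlt : (w (rootLo a)).val < (w (rootHi a)).val) :
    letterOp d n a (bv d n (permIdx r w)) = bv d n (permIdx r (w * letterPerm a)) := by
  cases a with
  | r h =>
    have hp : posX n ⟨0, h⟩ = rootHi (.r h) := by simp [posX, rootHi, xe]
    have hneg : rootLo (.r h) = negX n (rootHi (.r h)) := by
      simp [rootLo, rootHi, xe, xen, negX]
    have hpos : 0 < (w (posX n ⟨0, h⟩)).val := by
      rw [hneg, hw, negX_val] at hlt
      rw [hp]
      omega
    have key : Function.update (permIdx r w) ⟨0, h⟩
        (negX n (permIdx r w ⟨0, h⟩).1, (permIdx r w ⟨0, h⟩).2) =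
        permIdx r (w * letterPerm (.r h)) := by
      funext q
      rcases eq_or_ne q ⟨0, h⟩ with rfl | hq
      · have : letterPerm (.r h) (posX n ⟨0, h⟩) = negX n (posX n ⟨0, h⟩) := by
          apply Subtype.ext
          rw [letterPerm_r_val, negX_val, if_pos]
          simp [posX]
        simp only [Function.update_self, permIdx, Equiv.Perm.mul_apply, this, hw, absIdx_negX]
      · have : letterPerm (.r h) (posX n q) = posX n q := by
          apply Subtype.ext
          have : (q : ℕ) ≠ 0 := fun h0 => hq (Fin.ext h0)
          rw [letterPerm_r_val, if_neg]
          simp only [posX]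
          omega
        simp only [Function.update_of_ne hq, permIdx, Equiv.Perm.mul_apply, this]
    simp only [letterOp, BOp, dif_pos h, opOf_bv]
    rw [key, if_pos (show 0 < (permIdx r w ⟨0, h⟩).1.val from hpos), ite_self]
  | s i h1 h2 =>
    have hp : posX n ⟨i - 1, by omega⟩ = rootLo (.s i h1 h2) := by
      apply Subtype.ext
      simp only [posX, rootLo, xe]
      omega
    have hq : posX n ⟨i, by omega⟩ = rootHi (.s i h1 h2) := by
      simp [posX, rootHi, xe]
    rw [← hp, ← hq] at hlt
    have key : permIdx r w ∘ Equiv.swap (⟨i - 1, by omega⟩ : Fin n) ⟨i, by omega⟩ =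
        permIdx r (w * letterPerm (.s i h1 h2)) := by
      funext q
      have : posX n (Equiv.swap (⟨i - 1, by omega⟩ : Fin n) ⟨i, by omega⟩ q) =
          letterPerm (.s i h1 h2) (posX n q) := by
        apply Subtype.ext
        rw [letterPerm_s_val, Equiv.swap_apply_def]
        simp only [posX, Fin.ext_iff]
        split_ifs <;> (try dsimp only) <;> omega
      simp only [Function.comp_apply, permIdx, Equiv.Perm.mul_apply, this]
    simp only [letterOp, GOp, dif_pos (And.intro h1 h2), opOf_bv]
    rw [key, if_neg (show ¬ (permIdx r w ⟨i - 1, by omega⟩).1.val =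
        (permIdx r w ⟨i, by omega⟩).1.val from hlt.ne),
      if_pos (show (permIdx r w ⟨i - 1, by omega⟩).1.val <
        (permIdx r w ⟨i, by omega⟩).1.val from hlt), ite_self]

lemma prod_letterOp_bv_permIdx_one {d n : ℕ} (r : Fin n → Fin d) (L : List (Letter n))
    (hred : ∀ L' : List (Letter n), (L'.map letterPerm).prod = (L.map letterPerm).prod →
      L.length ≤ L'.length) :
    (L.map (letterOp d n)).reverse.prod (bv d n (permIdx r 1)) =
      bv d n (permIdx r (L.map letterPerm).prod) := by
  induction L using List.reverseRecOn with
  | nil => rfl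
  | append_singleton L a ih =>
    have := letterOp_bv_permIdx r _ (prod_letterPerm_negX L) a (root_lt_of_reduced a L hred)
    simp only [List.map_append, List.map_cons, List.map_nil, List.reverse_append,
      List.reverse_singleton, List.singleton_append, List.prod_cons, List.prod_append,
      List.prod_nil, mul_one, Module.End.mul_apply]
    rw [ih (reduced_of_append a L hred), this]

/-- if `w ∈ W_n` (a signed permutation of `X_n`) is parameterized by
`(m_1, …, m_n)` with `m_i = w(i)`, and `w = w_1 ⋯ w_m` is a reduced expression in the
Coxeter generators, then the operator `Φ_w = Φ(g_{w_1}) ⋯ Φ(g_{w_m})` (acting on the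
right, i.e. `Φ(g_{w_1})` is applied first) satisfies
`(v_1^{r_1} ⊗ ⋯ ⊗ v_n^{r_n}) Φ_w = v_{m_1}^{r_{|m_1|}} ⊗ ⋯ ⊗ v_{m_n}^{r_{|m_n|}}`. -/
theorem stmt6 (d n : ℕ) (hd : 1 ≤ d) (hn : 2 ≤ n)
    (w : Equiv.Perm (Xn n)) (hw : ∀ x : Xn n, w (negX n x) = negX n (w x))
    (L : List (Letter n))
    (hL : (L.map letterPerm).prod = w)
    (hred : ∀ L' : List (Letter n), (L'.map letterPerm).prod = w → L.length ≤ L'.length)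
    (r : Fin n → Fin d) :
    ((L.map (letterOp d n)).reverse.prod) (bv d n (fun p => (posX n p, r p))) =
      bv d n (fun p => (w (posX n p), r (absIdx n (w (posX n p))))) := by
  subst hL
  rw [show (fun p => (posX n p, r p)) = permIdx r 1 by
    funext p
    simp [permIdx, absIdx, posX, Int.natAbs_add_of_nonneg]]
  exact prod_letterOp_bv_permIdx_one r L hred
end
end
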